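/- If either (d ≥ 3 and L ≥ 3) or (d = 2 and L ≥ 4), the translation-symmetry maximally mixed invariant state ρ_T is entangled: there is no finite family of unit vectors ψ_α ∈ ℂ^d and probabilities p_α ≥ 0 summing to 1 such that ρ_T = ∑_α p_α (|ψ_α⟩⟨ψ_α|)^{⊗L}. Conversely, if (d = 2 and L ≤ 3) or L ≤ 2, such a decomposition exists. -/

import Mathlib

open scoped BigOperators

noncomputable section

/-- Cyclic shift by one site: `(shift σ) i = σ (i - 1)`. -/
def shift (d L : ℕ) (σ : ZMod L → Fin d) : ZMod L → Fin d := fun i => σ (i - 1)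

/-- The translation operator `T` on `H = (ℂ^d)^{⊗L}`. -/
def Tmat (d L : ℕ) [NeZero L] : Matrix (ZMod L → Fin d) (ZMod L → Fin d) ℂ :=
  Matrix.of fun τ σ => if τ = shift d L σ then 1 else 0

/-- The projector `P_T = (1/L)·∑_{k=0}^{L−1} T^k` onto the translation-invariant subspace. -/
def Pmat (d L : ℕ) [NeZero L] : Matrix (ZMod L → Fin d) (ZMod L → Fin d) ℂ :=
  (L : ℂ)⁻¹ • ∑ k ∈ Finset.range L, Tmat d L ^ k

/-- The maximally mixed invariant state of translation, `ρ_T = P_T / Tr(P_T)`. -/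
def rhoT (d L : ℕ) [NeZero L] : Matrix (ZMod L → Fin d) (ZMod L → Fin d) ℂ :=
  ((Pmat d L).trace)⁻¹ • Pmat d L

/-- The `L`-fold tensor (Kronecker) power `(|ψ⟩⟨ψ|)^{⊗L}` of the rank-one projection
onto `ψ ∈ ℂ^d`. -/
def pureTensorPow (d L : ℕ) [NeZero L] (ψ : Fin d → ℂ) :
    Matrix (ZMod L → Fin d) (ZMod L → Fin d) ℂ :=
  Matrix.of fun τ σ => (∏ i, ψ (τ i)) * (starRingEnd ℂ) (∏ i, ψ (σ i))

/-- Full separability into homogeneous product states: `ρ = ∑_α p_α (|ψ_α⟩⟨ψ_α|)^{⊗L}`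
for a finite family of probabilities `p_α` and unit vectors `ψ_α ∈ ℂ^d`. -/
def FullySepHom (d L : ℕ) [NeZero L]
    (ρ : Matrix (ZMod L → Fin d) (ZMod L → Fin d) ℂ) : Prop :=
  ∃ (n : ℕ) (p : Fin n → ℝ) (ψ : Fin n → Fin d → ℂ),
    (∀ α, 0 ≤ p α) ∧ (∑ α, p α = 1) ∧
    (∀ α, ∑ q, Complex.normSq (ψ α q) = 1) ∧
    ρ = ∑ α, (p α : ℂ) • pureTensorPow d L (ψ α)

theorem Tmat_pow_apply (d L : ℕ) [NeZero L] (k : ℕ) (τ σ : ZMod L → Fin d) :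
    (Tmat d L ^ k) τ σ = if τ = fun i => σ (i - k) then 1 else 0 := by
  induction k generalizing τ σ with
  | zero => simp [Matrix.one_apply]
  | succ k ih =>
    have hs : (fun i => shift d L σ (i - (k : ZMod L))) =
        fun i => σ (i - ((k + 1 : ℕ) : ZMod L)) := by
      funext i
      simp only [shift]
      congr 1
      push_cast
      ring
    rw [pow_succ, Matrix.mul_apply, ← hs]
    simp only [ih]
    simp [Tmat]

/-- The number of rotations taking `σ` to `τ`. -/
def rotCount {d L : ℕ} [NeZero L] (τ σ : ZMod L → Fin d) : ℕ :=
  ((Finset.range L).filter fun k : ℕ => ∀ i, τ i = σ (i - (k : ZMod L))).card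

theorem Pmat_apply (d L : ℕ) [NeZero L] (τ σ : ZMod L → Fin d) :
    Pmat d L τ σ = (L : ℂ)⁻¹ * rotCount τ σ := by
  simp [Pmat, rotCount, Matrix.sum_apply, Tmat_pow_apply, funext_iff]

theorem Pmat_self_ne_zero (d L : ℕ) [NeZero L] (σ : ZMod L → Fin d) : Pmat d L σ σ ≠ 0 := by
  rw [Pmat_apply]
  refine mul_ne_zero (inv_ne_zero (Nat.cast_ne_zero.2 (NeZero.ne L))) ?_
  rw [Nat.cast_ne_zero, rotCount]
  exact Finset.card_ne_zero_of_mem (a := 0) (by simp [NeZero.pos L])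

theorem Pmat_trace (d L : ℕ) [NeZero L] :
    (Pmat d L).trace = ((L : ℝ)⁻¹ * ∑ σ : ZMod L → Fin d, (rotCount σ σ : ℝ) : ℝ) := by
  simp [Matrix.trace, Pmat_apply, Finset.mul_sum]

theorem Pmat_trace_ne_zero (d L : ℕ) [NeZero L] (hd : 0 < d) : (Pmat d L).trace ≠ 0 := by
  rw [Pmat_trace, Complex.ofReal_ne_zero]
  refine mul_ne_zero (inv_ne_zero (Nat.cast_ne_zero.2 (NeZero.ne L))) (ne_of_gt ?_)
  have h (σ : ZMod L → Fin d) : (0 : ℝ) < rotCount σ σ := by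
    refine Nat.cast_pos.2 (Nat.pos_of_ne_zero fun h => Pmat_self_ne_zero d L σ ?_)
    simp [Pmat_apply, h]
  exact Finset.sum_pos (fun σ _ => h σ) ⟨fun _ => ⟨0, hd⟩, Finset.mem_univ _⟩

theorem FullySepHom.apply_comp_perm {d L : ℕ} [NeZero L]
    {ρ : Matrix (ZMod L → Fin d) (ZMod L → Fin d) ℂ} (h : FullySepHom d L ρ)
    (π : Equiv.Perm (ZMod L)) (τ σ : ZMod L → Fin d) : ρ (τ ∘ π) σ = ρ τ σ := by
  obtain ⟨n, p, ψ, -, -, -, rfl⟩ := h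
  simp only [Matrix.sum_apply, Matrix.smul_apply, pureTensorPow, Matrix.of_apply,
    Function.comp_apply]
  refine Finset.sum_congr rfl fun α _ => ?_
  rw [Equiv.prod_comp π fun i => ψ α (τ i)]

theorem not_fullySepHom_rhoT {d L : ℕ} [NeZero L] (hd : 0 < d) (σ : ZMod L → Fin d)
    (π : Equiv.Perm (ZMod L)) (h : ∀ k : ZMod L, ∃ i, σ (π i) ≠ σ (i - k)) :
    ¬ FullySepHom d L (rhoT d L) := by
  intro hs
  have h1 := hs.apply_comp_perm π σ σ
  have h2 : rotCount (σ ∘ π) σ = 0 := by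
    rw [rotCount, Finset.card_eq_zero, Finset.filter_eq_empty_iff]
    intro k _ hk
    obtain ⟨i, hi⟩ := h k
    exact hi (hk i)
  simp only [rhoT, Matrix.smul_apply, smul_eq_mul] at h1
  rw [Pmat_apply d L (σ ∘ π), h2, Nat.cast_zero, mul_zero, mul_zero] at h1
  exact mul_ne_zero (inv_ne_zero (Pmat_trace_ne_zero d L hd)) (Pmat_self_ne_zero d L σ) h1.symm

theorem natCast_zmod_ne_zero {L n : ℕ} (hn : 0 < n) (hL : n < L) : (n : ZMod L) ≠ 0 := by
  rw [Ne, ZMod.natCast_eq_zero_iff]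
  exact Nat.not_dvd_of_pos_of_lt hn hL

theorem not_fullySepHom_of_three_le {d L : ℕ} [NeZero L] (hd : 3 ≤ d) (hL : 3 ≤ L) :
    ¬ FullySepHom d L (rhoT d L) := by
  have h1 : (1 : ZMod L) ≠ 0 := by
    simpa using natCast_zmod_ne_zero (n := 1) (L := L) (by omega) (by omega)
  have h2 : (2 : ZMod L) ≠ 0 := by
    simpa using natCast_zmod_ne_zero (n := 2) (L := L) (by omega) (by omega)
  let a : Fin d := ⟨0, by omega⟩
  let b : Fin d := ⟨1, by omega⟩
  let c : Fin d := ⟨2, by omega⟩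
  have hab : a ≠ b := by simp [a, b]
  have hac : a ≠ c := by simp [a, c]
  have hbc : b ≠ c := by simp [b, c]
  let σ : ZMod L → Fin d := fun i => if i = 0 then b else if i = 1 then c else a
  refine not_fullySepHom_rhoT (by omega) σ (Equiv.swap 0 1) fun k => ?_
  by_contra! h
  -- the unique `b` of the permuted string sits at `1`, so `k = 1`
  have hk : k = 1 := by
    have := h 1
    simp only [Equiv.swap_apply_right, σ] at this
    grind
  have h3 : (0 : ZMod L) - 1 ≠ 1 := fun h => h2 (by linear_combination -h)
  have := h 0
  simp only [Equiv.swap_apply_left, σ, hk] at this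
  grind

theorem not_fullySepHom_of_four_le {d L : ℕ} [NeZero L] (hd : 2 ≤ d) (hL : 4 ≤ L) :
    ¬ FullySepHom d L (rhoT d L) := by
  have h1 : (1 : ZMod L) ≠ 0 := by
    simpa using natCast_zmod_ne_zero (n := 1) (L := L) (by omega) (by omega)
  have h2 : (2 : ZMod L) ≠ 0 := by
    simpa using natCast_zmod_ne_zero (n := 2) (L := L) (by omega) (by omega)
  have h3 : (3 : ZMod L) ≠ 0 := by
    simpa using natCast_zmod_ne_zero (n := 3) (L := L) (by omega) (by omega)
  let a : Fin d := ⟨0, by omega⟩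
  let b : Fin d := ⟨1, by omega⟩
  have hab : a ≠ b := by simp [a, b]
  let σ : ZMod L → Fin d := fun i => if i = 0 ∨ i = 1 then b else a
  refine not_fullySepHom_rhoT (by omega) σ (Equiv.swap 1 2) fun k => ?_
  by_contra! h
  have e0 := h 0
  have e2 := h 2
  rw [Equiv.swap_apply_of_ne_of_ne (by grind) (by grind)] at e0
  rw [Equiv.swap_apply_right] at e2
  simp only [σ] at e0 e2
  have e0' : 0 - k = 0 ∨ 0 - k = 1 := by grind
  have e2' : 2 - k = 0 ∨ 2 - k = 1 := by grind
  grind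

theorem pureTensorPow_smul (d L : ℕ) [NeZero L] (r : ℝ) (v : Fin d → ℂ) :
    pureTensorPow d L ((r : ℂ) • v) = ((r ^ 2) ^ L : ℂ) • pureTensorPow d L v := by
  ext τ σ
  simp [pureTensorPow, Finset.prod_mul_distrib, ZMod.card]
  ring

theorem pureTensorPow_trace (d L : ℕ) [NeZero L] (v : Fin d → ℂ) :
    (pureTensorPow d L v).trace = ((∑ q, Complex.normSq (v q)) ^ L : ℝ) := by
  have h := Finset.prod_univ_sum (fun _ : ZMod L => (Finset.univ : Finset (Fin d)))
    (fun _ q => (Complex.normSq (v q) : ℂ))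
  simp only [Finset.prod_const, Finset.card_univ, ZMod.card, Fintype.piFinset_univ] at h
  push_cast
  rw [h]
  simp [Matrix.trace, pureTensorPow, Complex.normSq_eq_conj_mul_self, Finset.prod_mul_distrib,
    mul_comm]

/-- An unnormalised decomposition into homogeneous product operators can be normalised. -/
theorem fullySepHom_trace_inv_smul {ι : Type*} [Fintype ι] {d L : ℕ} [NeZero L]
    {P : Matrix (ZMod L → Fin d) (ZMod L → Fin d) ℂ} (c : ι → ℝ) (v : ι → Fin d → ℂ)
    (hc : ∀ α, 0 ≤ c α) (hv : ∀ α, v α ≠ 0) (hP : P = ∑ α, (c α : ℂ) • pureTensorPow d L (v α))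
    (ht : P.trace ≠ 0) : FullySepHom d L (P.trace⁻¹ • P) := by
  set N : ι → ℝ := fun α => ∑ q, Complex.normSq (v α q) with hN
  have hNpos (α) : 0 < N α := by
    obtain ⟨q, hq⟩ := Function.ne_iff.1 (hv α)
    exact Finset.sum_pos' (fun q _ => Complex.normSq_nonneg _)
      ⟨q, Finset.mem_univ q, Complex.normSq_pos.2 hq⟩
  set t : ℝ := ∑ α, c α * N α ^ L with ht'
  have htr : P.trace = (t : ℂ) := by
    rw [hP, Matrix.trace_sum, ht', Complex.ofReal_sum]
    simp only [Matrix.trace_smul, pureTensorPow_trace, smul_eq_mul, Complex.ofReal_mul, hN]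
  have ht0 : t ≠ 0 := by simpa [htr] using ht
  have htnn : 0 ≤ t := Finset.sum_nonneg fun α _ => mul_nonneg (hc α) (pow_nonneg (hNpos α).le _)
  let e := (Fintype.equivFin ι).symm
  refine ⟨Fintype.card ι, fun α => t⁻¹ * (c (e α) * N (e α) ^ L),
    fun α => (((√(N (e α)))⁻¹ : ℝ) : ℂ) • v (e α), fun α => ?_, ?_, fun α => ?_, ?_⟩
  · have := hc (e α)
    have := hNpos (e α)
    positivity
  · rw [e.sum_comp fun α => t⁻¹ * (c α * N α ^ L), ← Finset.mul_sum, inv_mul_cancel₀ ht0]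
  · have h := hNpos (e α)
    simp only [Pi.smul_apply, smul_eq_mul, Complex.normSq_mul, Complex.normSq_ofReal,
      ← Finset.mul_sum, ← mul_inv, Real.mul_self_sqrt h.le]
    exact inv_mul_cancel₀ h.ne'
  · rw [htr]
    conv_lhs => rw [hP, Finset.smul_sum, ← e.sum_comp]
    refine Finset.sum_congr rfl fun α _ => ?_
    have h := hNpos (e α)
    rw [pureTensorPow_smul, smul_smul, smul_smul]
    congr 1
    norm_cast
    rw [inv_pow, Real.sq_sqrt h.le, inv_pow]
    field_simp

theorem sum_I_pow_mul_conj {a b : ℕ} (ha : a ≤ 3) (hb : b ≤ 3) :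
    ∑ k : Fin 4, (Complex.I ^ (k : ℕ)) ^ a * (starRingEnd ℂ) ((Complex.I ^ (k : ℕ)) ^ b) =
      if a = b then 4 else 0 := by
  have h2 := Complex.I_sq
  have h3 := Complex.I_pow_three
  interval_cases a <;> interval_cases b <;> simp [Fin.sum_univ_four, h2, h3] <;> norm_num <;>
    simp [pow_succ] <;> norm_num

theorem prod_comp_eq_prod_pow {d L : ℕ} [NeZero L] (z : Fin d → ℂ) (τ : ZMod L → Fin d) :
    ∏ i, z (τ i) = ∏ q, z q ^ (Finset.univ.filter fun j => τ j = q).card := by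
  rw [← Finset.prod_fiberwise' Finset.univ τ z]
  simp only [Finset.prod_const]

theorem sum_pureTensorPow_phases {d L : ℕ} [NeZero L] (hL : L ≤ 3) (τ σ : ZMod L → Fin d) :
    ∑ k : Fin d → Fin 4, pureTensorPow d L (fun q => Complex.I ^ (k q : ℕ)) τ σ =
      if ∀ q, (Finset.univ.filter fun j => τ j = q).card =
        (Finset.univ.filter fun j => σ j = q).card then 4 ^ d else 0 := by
  have hcard (ξ : ZMod L → Fin d) (q) : (Finset.univ.filter fun j => ξ j = q).card ≤ 3 :=
    (Finset.card_le_univ _).trans (by simpa [ZMod.card] using hL)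
  simp only [pureTensorPow, Matrix.of_apply]
  have h := Finset.prod_univ_sum (fun _ : Fin d => (Finset.univ : Finset (Fin 4)))
    (fun q k => (Complex.I ^ (k : ℕ)) ^ (Finset.univ.filter fun j => τ j = q).card *
      (starRingEnd ℂ) ((Complex.I ^ (k : ℕ)) ^ (Finset.univ.filter fun j => σ j = q).card))
  simp only [sum_I_pow_mul_conj (hcard _ _) (hcard _ _), Fintype.piFinset_univ] at h
  rw [Finset.prod_ite_zero] at h
  simp only [Finset.mem_univ, true_imp_iff, Finset.prod_const, Finset.card_univ,
    Fintype.card_fin] at h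
  rw [h]
  refine Finset.sum_congr rfl fun k _ => ?_
  rw [prod_comp_eq_prod_pow (fun q => Complex.I ^ (k q : ℕ)) τ,
    prod_comp_eq_prod_pow (fun q => Complex.I ^ (k q : ℕ)) σ, map_prod, Finset.prod_mul_distrib]

theorem sum_pureTensorPow_single {d L : ℕ} [NeZero L] (τ σ : ZMod L → Fin d) :
    ∑ q : Fin d, pureTensorPow d L (Pi.single q 1) τ σ =
      (Finset.univ.filter fun q => (∀ j, τ j = q) ∧ ∀ j, σ j = q).card := by
  rw [Finset.card_filter, Nat.cast_sum]
  refine Finset.sum_congr rfl fun q _ => ?_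
  simp only [pureTensorPow, Matrix.of_apply, Pi.single_apply, Finset.prod_ite_zero]
  by_cases h1 : ∀ j, τ j = q <;> by_cases h2 : ∀ j, σ j = q <;> simp [h1, h2]

/-- For these `d, L`, strings with the same letter counts are rotations of each other. -/
theorem rotCount_eq {d L : ℕ} [NeZero L] (h : (d = 2 ∧ L ≤ 3) ∨ L ≤ 2) (τ σ : ZMod L → Fin d) :
    rotCount τ σ = (if ∀ q, (Finset.univ.filter fun j => τ j = q).card =
        (Finset.univ.filter fun j => σ j = q).card then 1 else 0) +
      (L - 1) * (Finset.univ.filter fun q => (∀ j, τ j = q) ∧ ∀ j, σ j = q).card := by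
  have hpos := NeZero.pos L
  obtain rfl | rfl | ⟨rfl, rfl⟩ : L = 1 ∨ L = 2 ∨ d = 2 ∧ L = 3 := by omega
  · have hu : (Finset.univ : Finset (ZMod 1)) = {0} := rfl
    have hall (p : ZMod 1 → Prop) : (∀ j, p j) ↔ p 0 :=
      ⟨fun h => h 0, fun h j => by rwa [Subsingleton.elim j 0]⟩
    have hc : (∀ q, (Finset.univ.filter fun j => τ j = q).card =
        (Finset.univ.filter fun j => σ j = q).card) ↔ τ 0 = σ 0 := by
      simp only [hu, Finset.card_filter, Finset.sum_singleton]
      constructor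
      · intro h
        have := h (τ 0)
        grind
      · grind
    rw [rotCount, if_congr hc rfl rfl]
    simp only [hall, Finset.card_filter, Finset.sum_range_one, Nat.cast_zero, sub_zero, tsub_self,
      zero_mul, add_zero]
  · have hu : (Finset.univ : Finset (ZMod 2)) = {0, 1} := rfl
    have hall (p : ZMod 2 → Prop) : (∀ j, p j) ↔ p 0 ∧ p 1 := Fin.forall_fin_two
    have hq : (Finset.univ.filter fun q => (∀ j, τ j = q) ∧ ∀ j, σ j = q).card =
        if τ 0 = τ 1 ∧ σ 0 = τ 0 ∧ σ 1 = τ 0 then 1 else 0 := by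
      split_ifs with h
      · rw [Finset.card_eq_one]
        refine ⟨τ 0, ?_⟩
        ext q
        simp only [hall, Finset.mem_filter, Finset.mem_univ, Finset.mem_singleton]
        grind
      · rw [Finset.card_eq_zero, Finset.filter_eq_empty_iff]
        intro q _
        simp only [hall]
        grind
    have hc : (∀ q, (Finset.univ.filter fun j => τ j = q).card =
        (Finset.univ.filter fun j => σ j = q).card) ↔
        (τ 0 = σ 0 ∧ τ 1 = σ 1) ∨ (τ 0 = σ 1 ∧ τ 1 = σ 0) := by
      simp only [hu, Finset.card_filter, Finset.sum_pair (zero_ne_one (α := ZMod 2))]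
      constructor
      · intro h
        have := h (τ 0)
        have := h (τ 1)
        grind
      · grind
    have e : (1 : ZMod 2) - 1 = 0 ∧ (0 : ZMod 2) - 1 = 1 := by decide
    rw [hq, rotCount, if_congr hc rfl rfl]
    simp only [hall, Finset.card_filter, Finset.sum_range_succ, Finset.sum_range_zero,
      Nat.cast_zero, Nat.cast_one, sub_zero, e]
    grind
  · rw [rotCount]
    rename_i inst
    obtain rfl : inst = ⟨by decide⟩ := rfl
    clear h hpos
    decide +revert

theorem fullySepHom_rhoT {d L : ℕ} [NeZero L] (hd : 2 ≤ d) (h : (d = 2 ∧ L ≤ 3) ∨ L ≤ 2) :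
    FullySepHom d L (rhoT d L) := by
  have hL : 1 ≤ L := NeZero.pos L
  refine fullySepHom_trace_inv_smul (ι := (Fin d → Fin 4) ⊕ Fin d)
    (Sum.elim (fun _ => (L : ℝ)⁻¹ * (4 ^ d)⁻¹) fun _ => (L : ℝ)⁻¹ * (L - 1 : ℕ))
    (Sum.elim (fun k q => Complex.I ^ (k q : ℕ)) fun q => Pi.single q 1) ?_ ?_ ?_
    (Pmat_trace_ne_zero d L (by omega))
  · rintro (k | q) <;> simp only [Sum.elim_inl, Sum.elim_inr] <;> positivity
  · rintro (k | q)
    · exact fun h0 => by simpa using congrFun h0 ⟨0, by omega⟩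
    · simp
  · ext τ σ
    simp only [Fintype.sum_sum_type, Sum.elim_inl, Sum.elim_inr, Matrix.smul_apply,
      Matrix.sum_apply, smul_eq_mul]
    rw [← Finset.mul_sum, ← Finset.mul_sum, sum_pureTensorPow_phases (by omega), sum_pureTensorPow_single, Pmat_apply, rotCount_eq h]
    push_cast
    split_ifs
    · field_simp
    · field_simp
      ring

/-- if `(d ≥ 3 and L ≥ 3)` or `(d = 2 and L ≥ 4)`, the translation-symmetry
MMIS `ρ_T` is entangled (not fully separable into homogeneous product states);
conversely, if `(d = 2 and L ≤ 3)` or `L ≤ 2`, such a decomposition exists. -/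
theorem stmt7 (d L : ℕ) [NeZero L] (hd : 2 ≤ d) (hL : 1 ≤ L) :
    (((3 ≤ d ∧ 3 ≤ L) ∨ (d = 2 ∧ 4 ≤ L)) → ¬ FullySepHom d L (rhoT d L)) ∧
    (((d = 2 ∧ L ≤ 3) ∨ L ≤ 2) → FullySepHom d L (rhoT d L)) := by
  refine ⟨?_, fullySepHom_rhoT hd⟩
  rintro (⟨hd3, hL3⟩ | ⟨-, hL4⟩)
  · exact not_fullySepHom_of_three_le hd3 hL3
  · exact not_fullySepHom_of_four_le hd hL4
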